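/- Let D be connected and let L be a two-dimensional complex Finsler metric on D such that R_{r̄jh̄k} = 𝒦·(g_{jr̄}·g_{kh̄} + g_{kr̄}·g_{jh̄}) at every point of D for all indices r,j,h,k, where 𝒦 : D → ℝ is a nowhere-zero function (smooth in the underlying real variables). Then 𝒦 is constant on D if and only if L is Kähler. -/

import Mathlib

open Complex

noncomputable section

namespace CFinsler

/-- A point of `T'M` in local coordinates: `(z, η) ∈ ℂⁿ × ℂⁿ`. -/
abbrev Pt (n : ℕ) := (Fin n → ℂ) × (Fin n → ℂ)

variable {n : ℕ}

/-- Wirtinger derivative `∂f/∂z^k`. -/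
def dz (f : Pt n → ℂ) (k : Fin n) (p : Pt n) : ℂ :=
  (1 / 2) * (fderiv ℝ f p ((Pi.single k 1 : Fin n → ℂ), 0) -
    Complex.I * fderiv ℝ f p ((Pi.single k Complex.I : Fin n → ℂ), 0))

/-- Wirtinger derivative `∂f/∂z̄^k`. -/
def dzbar (f : Pt n → ℂ) (k : Fin n) (p : Pt n) : ℂ :=
  (1 / 2) * (fderiv ℝ f p ((Pi.single k 1 : Fin n → ℂ), 0) +
    Complex.I * fderiv ℝ f p ((Pi.single k Complex.I : Fin n → ℂ), 0))

/-- Wirtinger derivative `∂f/∂η^k`. -/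
def de (f : Pt n → ℂ) (k : Fin n) (p : Pt n) : ℂ :=
  (1 / 2) * (fderiv ℝ f p (0, (Pi.single k 1 : Fin n → ℂ)) -
    Complex.I * fderiv ℝ f p (0, (Pi.single k Complex.I : Fin n → ℂ)))

/-- Wirtinger derivative `∂f/∂η̄^k`. -/
def debar (f : Pt n → ℂ) (k : Fin n) (p : Pt n) : ℂ :=
  (1 / 2) * (fderiv ℝ f p (0, (Pi.single k 1 : Fin n → ℂ)) +
    Complex.I * fderiv ℝ f p (0, (Pi.single k Complex.I : Fin n → ℂ)))

/-- The fundamental metric tensor `g_{i j̄} := ∂²L/∂η^i ∂η̄^j`. -/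
def gm (L : Pt n → ℂ) (i j : Fin n) : Pt n → ℂ := de (debar L j) i

/-- `L` is an `n`-dimensional complex Finsler metric on `D`. -/
structure IsCFM (n : ℕ) (D : Set (Pt n)) (L : Pt n → ℂ) : Prop where
  openD : IsOpen D
  fiber_ne : ∀ p ∈ D, p.2 ≠ 0
  conic : ∀ p ∈ D, ∀ lam : ℂ, lam ≠ 0 → (p.1, lam • p.2) ∈ D
  smooth : ContDiffOn ℝ (⊤ : ℕ∞) L D
  real_im : ∀ p ∈ D, (L p).im = 0
  pos : ∀ p ∈ D, 0 < (L p).re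
  homog : ∀ p ∈ D, ∀ lam : ℂ, lam ≠ 0 →
    L (p.1, lam • p.2) = ((Complex.normSq lam : ℝ) : ℂ) * L p
  hermitian : ∀ p ∈ D, ∀ i j, (starRingEnd ℂ) (gm L i j p) = gm L j i p
  posdef : ∀ p ∈ D, ∀ v : Fin n → ℂ, v ≠ 0 →
    0 < (∑ i, ∑ j, gm L i j p * v i * (starRingEnd ℂ) (v j)).re

variable (L : Pt n → ℂ)

/-- The metric tensor as a matrix at a point. -/
def gmat (p : Pt n) : Matrix (Fin n) (Fin n) ℂ := fun i j => gm L i j p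

/-- The inverse metric tensor `g^{l̄ i}`. -/
def gi (l i : Fin n) (p : Pt n) : ℂ := (gmat L p)⁻¹ l i

/-- The Chern–Finsler nonlinear connection coefficients
`N^i_k := g^{m̄ i} (∂g_{l m̄}/∂z^k) η^l`. -/
def Nc (i k : Fin n) (p : Pt n) : ℂ :=
  ∑ m, ∑ l, gi L m i p * dz (gm L l m) k p * p.2 l

/-- The horizontal derivation `δ_k := ∂/∂z^k − N^j_k ∂/∂η^j`. -/
def del (f : Pt n → ℂ) (k : Fin n) (p : Pt n) : ℂ :=
  dz f k p - ∑ j, Nc L j k p * de f j p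

/-- The conjugate horizontal derivation `δ_k̄ := ∂/∂z̄^k − N̄^j_k ∂/∂η̄^j`. -/
def delbar (f : Pt n → ℂ) (k : Fin n) (p : Pt n) : ℂ :=
  dzbar f k p - ∑ j, (starRingEnd ℂ) (Nc L j k p) * debar f j p

/-- The horizontal Chern–Finsler connection coefficients `L^i_{jk} := g^{l̄ i} δ_k(g_{j l̄})`. -/
def Lc (i j k : Fin n) (p : Pt n) : ℂ := ∑ l, gi L l i p * del L (gm L j l) k p

/-- The vertical Chern–Finsler connection coefficients `C^i_{jk} := g^{l̄ i} ∂g_{j l̄}/∂η^k`. -/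
def Cc (i j k : Fin n) (p : Pt n) : ℂ := ∑ l, gi L l i p * de (gm L j l) k p

/-- The spray coefficients `G^i := ½ N^i_j η^j`. -/
def Gs (i : Fin n) (p : Pt n) : ℂ := (1 / 2) * ∑ j, Nc L i j p * p.2 j

/-- The canonical horizontal derivation `δ̊_k := ∂/∂z^k − (∂G^j/∂η^k) ∂/∂η^j`. -/
def delc (f : Pt n → ℂ) (k : Fin n) (p : Pt n) : ℂ :=
  dz f k p - ∑ j, de (Gs L j) k p * de f j p

/-- `F := √L`. -/
def Fh (p : Pt n) : ℂ := (Real.sqrt ((L p).re) : ℂ)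

/-- `l^i := η^i / F`. -/
def lup (i : Fin n) (p : Pt n) : ℂ := p.2 i / Fh L p

/-- `l_i := g_{i j̄} η̄^j / F`. -/
def llow (i : Fin n) (p : Pt n) : ℂ :=
  (∑ j, gm L i j p * (starRingEnd ℂ) (p.2 j)) / Fh L p

/-- `√g` where `g := det(g_{i j̄})`. -/
def sg (p : Pt n) : ℂ := (Real.sqrt ((gmat L p).det.re) : ℂ)

/-- The metric is Kähler. -/
def IsKahler (D : Set (Pt n)) : Prop := ∀ p ∈ D, ∀ i j k, Lc L i j k p = Lc L i k j p

/-- The metric is weakly Kähler. -/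
def IsWeaklyKahler (D : Set (Pt n)) : Prop :=
  ∀ p ∈ D, ∀ k, (∑ i, ∑ j, ∑ l, gm L i l p * (Lc L i j k p - Lc L i k j p) *
    p.2 j * (starRingEnd ℂ) (p.2 l)) = 0

/-- The metric is purely Hermitian: `g_{i j̄}` does not depend on the fibre variable. -/
def IsPurelyHermitian (D : Set (Pt n)) : Prop :=
  ∀ p ∈ D, ∀ i j k, de (gm L i j) k p = 0 ∧ debar (gm L i j) k p = 0

/-- The metric is a complex Berwald metric: Kähler with `L^i_{jk}` independent of the
fibre variable. -/
def IsBerwald (D : Set (Pt n)) : Prop :=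
  IsKahler L D ∧ ∀ p ∈ D, ∀ i j k l, de (Lc L i j k) l p = 0 ∧ debar (Lc L i j k) l p = 0

/-- The metric is a complex Landsberg metric: the Berwald and Rund connections coincide. -/
def IsLandsberg (D : Set (Pt n)) : Prop :=
  ∀ p ∈ D, ∀ i j k, de (de (Gs L i) k) j p =
    (1 / 2) * ∑ l, gi L l i p * (delc L (gm L j l) k p + delc L (gm L k l) j p)

/-- `m^i` of the local complex Berwald frame: `m¹ = −l₂/√g`, `m² = l₁/√g`. -/
def mup (L : Pt 2 → ℂ) (i : Fin 2) (p : Pt 2) : ℂ :=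
  if i = 0 then -(llow L 1 p) / sg L p else llow L 0 p / sg L p

/-- `m_i := g_{i j̄} m̄^j`. -/
def mlow (L : Pt 2 → ℂ) (i : Fin 2) (p : Pt 2) : ℂ :=
  ∑ j, gm L i j p * (starRingEnd ℂ) (mup L j p)

/-- `A := m^j m^k l_h C^h_{kj}`. -/
def sA (L : Pt 2 → ℂ) (p : Pt 2) : ℂ :=
  ∑ j, ∑ k, ∑ h, mup L j p * mup L k p * llow L h p * Cc L h k j p

/-- `B := m_h m^k m^j C^h_{jk}`. -/
def sB (L : Pt 2 → ℂ) (p : Pt 2) : ℂ :=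
  ∑ j, ∑ k, ∑ h, mlow L h p * mup L k p * mup L j p * Cc L h j k p

/-- `J := l^j l^k l_i L^i_{jk}`. -/
def sJ (L : Pt 2 → ℂ) (p : Pt 2) : ℂ :=
  ∑ j, ∑ k, ∑ i, lup L j p * lup L k p * llow L i p * Lc L i j k p

/-- `U := m^j l^k l_i L^i_{jk}`. -/
def sU (L : Pt 2 → ℂ) (p : Pt 2) : ℂ :=
  ∑ j, ∑ k, ∑ i, mup L j p * lup L k p * llow L i p * Lc L i j k p

/-- `V := l^j m^k l_i L^i_{jk}`. -/
def sV (L : Pt 2 → ℂ) (p : Pt 2) : ℂ :=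
  ∑ j, ∑ k, ∑ i, lup L j p * mup L k p * llow L i p * Lc L i j k p

/-- `X := m^j m^k l_i L^i_{jk}`. -/
def sX (L : Pt 2 → ℂ) (p : Pt 2) : ℂ :=
  ∑ j, ∑ k, ∑ i, mup L j p * mup L k p * llow L i p * Lc L i j k p

/-- `O := l^j l^k m_i L^i_{jk}`. -/
def sO (L : Pt 2 → ℂ) (p : Pt 2) : ℂ :=
  ∑ j, ∑ k, ∑ i, lup L j p * lup L k p * mlow L i p * Lc L i j k p

/-- `Y := m^j l^k m_i L^i_{jk}`. -/
def sY (L : Pt 2 → ℂ) (p : Pt 2) : ℂ :=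
  ∑ j, ∑ k, ∑ i, mup L j p * lup L k p * mlow L i p * Lc L i j k p

/-- `E := l^j m^k m_i L^i_{jk}`. -/
def sE (L : Pt 2 → ℂ) (p : Pt 2) : ℂ :=
  ∑ j, ∑ k, ∑ i, lup L j p * mup L k p * mlow L i p * Lc L i j k p

/-- `H := m^j m^k m_i L^i_{jk}`. -/
def sH (L : Pt 2 → ℂ) (p : Pt 2) : ℂ :=
  ∑ j, ∑ k, ∑ i, mup L j p * mup L k p * mlow L i p * Lc L i j k p

/-- The vertical curvature invariant `I := −(∂B/∂η̄^s) m̄^s − B B̄/2`. -/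
def vI (L : Pt 2 → ℂ) (p : Pt 2) : ℂ :=
  -(∑ s, debar (sB L) s p * (starRingEnd ℂ) (mup L s p)) -
    sB L p * (starRingEnd ℂ) (sB L p) / 2

/-- The `v v̄`-Riemann type tensor `S_{r̄ j h̄ k} := −g_{i r̄} ∂C^i_{jk}/∂η̄^h`. -/
def Sv (L : Pt 2 → ℂ) (r j h k : Fin 2) (p : Pt 2) : ℂ :=
  -∑ i, gm L i r p * debar (Cc L i j k) h p

/-- The `h h̄`-Riemann type tensor
`R_{r̄ j h̄ k} := g_{i r̄} (−δ_h̄(L^i_{jk}) − δ_h̄(N^l_k) C^i_{jl})`. -/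
def Rh (L : Pt 2 → ℂ) (r j h k : Fin 2) (p : Pt 2) : ℂ :=
  ∑ i, gm L i r p *
    (-(delbar L (Lc L i j k) h p) - ∑ l, delbar L (Nc L l k) h p * Cc L i j l p)

/-- The horizontal curvature invariant `K := −(1/F) δ_k̄(J) η̄^k`. -/
def hK (L : Pt 2 → ℂ) (p : Pt 2) : ℂ :=
  -(1 / Fh L p) * ∑ k, delbar L (sJ L) k p * (starRingEnd ℂ) (p.2 k)

/-- The horizontal curvature invariant
`W := −δ_s̄(H) m̄^s − ½ H (V̄+H̄) − B F δ_s̄(E) m̄^s`. -/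
def hW (L : Pt 2 → ℂ) (p : Pt 2) : ℂ :=
  -(∑ s, delbar L (sH L) s p * (starRingEnd ℂ) (mup L s p)) -
    (1 / 2) * sH L p * ((starRingEnd ℂ) (sV L p) + (starRingEnd ℂ) (sH L p)) -
    sB L p * Fh L p * ∑ s, delbar L (sE L) s p * (starRingEnd ℂ) (mup L s p)

/-- The weak symmetry condition `R_{0̄ k 0̄ 0} = R_{0̄ 0 0̄ k}`, i.e.
`R_{r̄ k h̄ s} η̄^r η̄^h η^s = R_{r̄ s h̄ k} η̄^r η^s η̄^h`. -/
def WeakSym (L : Pt 2 → ℂ) (D : Set (Pt 2)) : Prop :=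
  ∀ p ∈ D, ∀ k,
    (∑ r, ∑ h, ∑ s, Rh L r k h s p * (starRingEnd ℂ) (p.2 r) *
      (starRingEnd ℂ) (p.2 h) * p.2 s) =
    ∑ r, ∑ s, ∑ h, Rh L r s h k p * (starRingEnd ℂ) (p.2 r) * p.2 s *
      (starRingEnd ℂ) (p.2 h)

section Wirtinger

variable {E : Type*} [NormedAddCommGroup E] [NormedSpace ℝ E]

/-- The derivative of `f` along the complexified tangent vector `X.1 + i X.2`. -/
def cd (X : E × E) (f : E → ℂ) (p : E) : ℂ := fderiv ℝ f p X.1 + I * fderiv ℝ f p X.2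

/-- Smooth complex-valued functions on `D`. -/
abbrev Sm (D : Set E) (f : E → ℂ) : Prop := ContDiffOn ℝ (⊤ : ℕ∞) f D

variable {D : Set E} {f g : E → ℂ} {p : E}

theorem Sm.contDiffAt (hf : Sm D f) (hD : IsOpen D) (hp : p ∈ D) :
    ContDiffAt ℝ (⊤ : ℕ∞) f p :=
  ContDiffOn.contDiffAt hf (hD.mem_nhds hp)

theorem Sm.differentiableAt (hf : Sm D f) (hD : IsOpen D) (hp : p ∈ D) :
    DifferentiableAt ℝ f p :=
  (hf.contDiffAt hD hp).differentiableAt (by simp)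

theorem Sm.fderiv (hf : Sm D f) (hD : IsOpen D) :
    ContDiffOn ℝ (⊤ : ℕ∞) (fderiv ℝ f) D :=
  ContDiffOn.fderiv_of_isOpen hf hD (by simp)

theorem Sm.cd (hf : Sm D f) (hD : IsOpen D) (X : E × E) : Sm D (cd X f) :=
  ((hf.fderiv hD).clm_apply contDiffOn_const).add
    (contDiffOn_const.mul ((hf.fderiv hD).clm_apply contDiffOn_const))

theorem cd_congr (hD : IsOpen D) (h : ∀ q ∈ D, f q = g q) (X : E × E) (hp : p ∈ D) :
    cd X f p = cd X g p := by
  have : f =ᶠ[nhds p] g := Filter.eventuallyEq_of_mem (hD.mem_nhds hp) h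
  simp [cd, this.fderiv_eq]

theorem cd_const (X : E × E) (c : ℂ) : cd X (fun _ => c) p = 0 := by
  simp [cd]

theorem cd_add (hD : IsOpen D) (hf : Sm D f) (hg : Sm D g) (X : E × E) (hp : p ∈ D) :
    cd X (fun q => f q + g q) p = cd X f p + cd X g p := by
  simp only [cd, fderiv_fun_add (hf.differentiableAt hD hp) (hg.differentiableAt hD hp)]
  simp; ring

theorem cd_mul (hD : IsOpen D) (hf : Sm D f) (hg : Sm D g) (X : E × E) (hp : p ∈ D) :
    cd X (fun q => f q * g q) p = cd X f p * g p + f p * cd X g p := by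
  simp only [cd, fderiv_fun_mul (hf.differentiableAt hD hp) (hg.differentiableAt hD hp)]
  simp; ring

theorem cd_sum {ι : Type*} [Fintype ι] {f : ι → E → ℂ} (hD : IsOpen D)
    (hf : ∀ i, Sm D (f i)) (X : E × E) (hp : p ∈ D) :
    cd X (fun q => ∑ i, f i q) p = ∑ i, cd X (f i) p := by
  simp only [cd, fderiv_fun_sum fun i _ => (hf i).differentiableAt hD hp]
  simp [Finset.sum_add_distrib, Finset.mul_sum]

theorem cd_sum_mul {ι : Type*} [Fintype ι] {f g : ι → E → ℂ} (hD : IsOpen D)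
    (hf : ∀ i, Sm D (f i)) (hg : ∀ i, Sm D (g i)) (X : E × E) (hp : p ∈ D) :
    cd X (fun q => ∑ i, f i q * g i q) p =
      ∑ i, (cd X (f i) p * g i p + f i p * cd X (g i) p) := by
  rw [cd_sum (f := fun i q => f i q * g i q) hD (fun i => (hf i).mul (hg i)) X hp]
  exact Finset.sum_congr rfl fun i _ => cd_mul hD (hf i) (hg i) X hp

theorem cd_comm (hD : IsOpen D) (hf : Sm D f) (X Y : E × E) (hp : p ∈ D) :
    cd X (cd Y f) p = cd Y (cd X f) p := by
  have hd : DifferentiableAt ℝ (fderiv ℝ f) p :=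
    ((hf.fderiv hD).contDiffAt (hD.mem_nhds hp)).differentiableAt (by simp)
  have hs : IsSymmSndFDerivAt ℝ f p :=
    (hf.contDiffAt hD hp).isSymmSndFDerivAt
      (by rw [minSmoothness_of_isRCLikeNormedField]; exact WithTop.coe_le_coe.2 (le_top : (2 : ℕ∞) ≤ ⊤))
  have key : ∀ Z W : E × E, cd Z (cd W f) p =
      fderiv ℝ (fderiv ℝ f) p Z.1 W.1 + I * fderiv ℝ (fderiv ℝ f) p Z.1 W.2 +
      I * (fderiv ℝ (fderiv ℝ f) p Z.2 W.1 + I * fderiv ℝ (fderiv ℝ f) p Z.2 W.2) := by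
    intro Z W
    have h : HasFDerivAt (cd W f) _ p :=
      ((hd.hasFDerivAt.clm_apply (hasFDerivAt_const W.1 p)).add
        ((hd.hasFDerivAt.clm_apply (hasFDerivAt_const W.2 p)).const_mul I))
    rw [cd, h.fderiv]
    simp
  rw [key, key, hs X.1 Y.1, hs X.1 Y.2, hs X.2 Y.1, hs X.2 Y.2]
  ring

theorem conj_cd (hf : DifferentiableAt ℝ f p) (X : E × E) :
    (starRingEnd ℂ) (cd X f p) = cd (X.1, -X.2) (fun q => (starRingEnd ℂ) (f q)) p := by
  have h : HasFDerivAt (fun q => (starRingEnd ℂ) (f q))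
      ((conjCLE : ℂ →L[ℝ] ℂ).comp (fderiv ℝ f p)) p :=
    (conjCLE : ℂ →L[ℝ] ℂ).hasFDerivAt.comp p hf.hasFDerivAt
  simp [cd, h.fderiv]

end Wirtinger
section Frame

variable {n : ℕ}

/-- The complexified tangent vector `∂/∂z^k`. -/
def vz (k : Fin n) : Pt n × Pt n :=
  ((1 / 2 : ℝ) • (Pi.single k 1, 0), (-1 / 2 : ℝ) • (Pi.single k I, 0))

/-- The complexified tangent vector `∂/∂z̄^k`. -/
def vzb (k : Fin n) : Pt n × Pt n :=
  ((1 / 2 : ℝ) • (Pi.single k 1, 0), (1 / 2 : ℝ) • (Pi.single k I, 0))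

/-- The complexified tangent vector `∂/∂η^k`. -/
def ve (k : Fin n) : Pt n × Pt n :=
  ((1 / 2 : ℝ) • (0, Pi.single k 1), (-1 / 2 : ℝ) • (0, Pi.single k I))

/-- The complexified tangent vector `∂/∂η̄^k`. -/
def veb (k : Fin n) : Pt n × Pt n :=
  ((1 / 2 : ℝ) • (0, Pi.single k 1), (1 / 2 : ℝ) • (0, Pi.single k I))

theorem dz_eq (f : Pt n → ℂ) (k : Fin n) : dz f k = cd (vz k) f := by
  funext p
  simp only [dz, cd, vz, map_smul, Complex.real_smul]
  push_cast; ring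

theorem dzbar_eq (f : Pt n → ℂ) (k : Fin n) : dzbar f k = cd (vzb k) f := by
  funext p
  simp only [dzbar, cd, vzb, map_smul, Complex.real_smul]
  push_cast; ring

theorem de_eq (f : Pt n → ℂ) (k : Fin n) : de f k = cd (ve k) f := by
  funext p
  simp only [de, cd, ve, map_smul, Complex.real_smul]
  push_cast; ring

theorem debar_eq (f : Pt n → ℂ) (k : Fin n) : debar f k = cd (veb k) f := by
  funext p
  simp only [debar, cd, veb, map_smul, Complex.real_smul]
  push_cast; ring

theorem gm_eq (L : Pt n → ℂ) (i j : Fin n) : gm L i j = cd (ve i) (cd (veb j) L) := by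
  rw [gm, de_eq, debar_eq]

/-- The fibre coordinate `η^i`. -/
def eta (i : Fin n) (p : Pt n) : ℂ := p.2 i

/-- The conjugate fibre coordinate `η̄^i`. -/
def etab (i : Fin n) (p : Pt n) : ℂ := (starRingEnd ℂ) (p.2 i)

theorem eta_smooth (D : Set (Pt n)) (i : Fin n) : Sm D (eta i) := by
  have : ContDiff ℝ (⊤ : ℕ∞) (eta (n := n) i) :=
    (contDiff_apply ℝ ℂ i).comp contDiff_snd
  exact this.contDiffOn

theorem etab_smooth (D : Set (Pt n)) (i : Fin n) : Sm D (etab i) := by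
  have : ContDiff ℝ (⊤ : ℕ∞) (etab (n := n) i) :=
    (conjCLE : ℂ →L[ℝ] ℂ).contDiff.comp ((contDiff_apply ℝ ℂ i).comp contDiff_snd)
  exact this.contDiffOn

theorem cd_eta (X : Pt n × Pt n) (i : Fin n) (p : Pt n) :
    cd X (eta i) p = X.1.2 i + I * X.2.2 i := by
  have h : HasFDerivAt (eta (n := n) i) ((ContinuousLinearMap.proj (R := ℝ) i).comp
      (ContinuousLinearMap.snd ℝ (Fin n → ℂ) (Fin n → ℂ))) p :=
    ((ContinuousLinearMap.proj (R := ℝ) i).comp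
      (ContinuousLinearMap.snd ℝ (Fin n → ℂ) (Fin n → ℂ))).hasFDerivAt
  simp [cd, h.fderiv]

theorem cd_etab (X : Pt n × Pt n) (i : Fin n) (p : Pt n) :
    cd X (etab i) p = (starRingEnd ℂ) (X.1.2 i) + I * (starRingEnd ℂ) (X.2.2 i) := by
  have h : HasFDerivAt (etab (n := n) i) ((conjCLE : ℂ →L[ℝ] ℂ).comp
      ((ContinuousLinearMap.proj (R := ℝ) i).comp
        (ContinuousLinearMap.snd ℝ (Fin n → ℂ) (Fin n → ℂ)))) p :=
    ((conjCLE : ℂ →L[ℝ] ℂ).comp ((ContinuousLinearMap.proj (R := ℝ) i).comp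
      (ContinuousLinearMap.snd ℝ (Fin n → ℂ) (Fin n → ℂ)))).hasFDerivAt
  simp [cd, h.fderiv]

@[simp] theorem cd_ve_eta (k i : Fin n) (p : Pt n) :
    cd (ve k) (eta i) p = if i = k then 1 else 0 := by
  by_cases h : i = k
  · subst h; simp [cd_eta, ve]; linear_combination (-1 / 2) * I_mul_I
  · simp [cd_eta, ve, h]

@[simp] theorem cd_veb_etab (k i : Fin n) (p : Pt n) :
    cd (veb k) (etab i) p = if i = k then 1 else 0 := by
  by_cases h : i = k
  · subst h; simp [cd_etab, veb, conj_ofNat]; linear_combination (-1 / 2) * I_mul_I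
  · simp [cd_etab, veb, h]

@[simp] theorem cd_veb_eta (k i : Fin n) (p : Pt n) : cd (veb k) (eta i) p = 0 := by
  by_cases h : i = k
  · subst h; simp [cd_eta, veb]; linear_combination (1 / 2) * I_mul_I
  · simp [cd_eta, veb, h]

@[simp] theorem cd_ve_etab (k i : Fin n) (p : Pt n) : cd (ve k) (etab i) p = 0 := by
  by_cases h : i = k
  · subst h; simp [cd_etab, ve, conj_ofNat]; linear_combination (1 / 2) * I_mul_I
  · simp [cd_etab, ve, h]

@[simp] theorem cd_vz_eta (k i : Fin n) (p : Pt n) : cd (vz k) (eta i) p = 0 := by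
  simp [cd_eta, vz]

@[simp] theorem cd_vz_etab (k i : Fin n) (p : Pt n) : cd (vz k) (etab i) p = 0 := by
  simp [cd_etab, vz]

@[simp] theorem cd_vzb_eta (k i : Fin n) (p : Pt n) : cd (vzb k) (eta i) p = 0 := by
  simp [cd_eta, vzb]

/-- A real-linear functional applied to a complex multiple of a coordinate vector. -/
theorem real_linear_single (φ : (Fin n → ℂ) →L[ℝ] ℂ) (v : Fin n → ℂ) :
    φ v = ∑ k, (v k * ((1 / 2) * (φ (Pi.single k 1) - I * φ (Pi.single k I))) +
      (starRingEnd ℂ) (v k) * ((1 / 2) * (φ (Pi.single k 1) + I * φ (Pi.single k I)))) := by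
  conv_lhs => rw [← Finset.univ_sum_single v, map_sum]
  refine Finset.sum_congr rfl fun k _ => ?_
  have h : (Pi.single k (v k) : Fin n → ℂ) =
      (v k).re • (Pi.single k 1 : Fin n → ℂ) + (v k).im • (Pi.single k I : Fin n → ℂ) := by
    rw [← Pi.single_smul, ← Pi.single_smul, ← Pi.single_add]
    congr 1
    simp [Complex.re_add_im]
  rw [h, map_add, map_smul, map_smul, Complex.real_smul, Complex.real_smul]
  have h1 : (v k) = (v k).re + (v k).im * I := (re_add_im _).symm
  have h2 : (starRingEnd ℂ) (v k) = (v k).re - (v k).im * I := by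
    apply Complex.ext <;> simp
  rw [h2]
  conv_rhs => rw [h1]
  simp only [add_re, ofReal_re, mul_re, I_re, mul_zero, ofReal_im, I_im, mul_one, sub_self,
    add_zero, add_im, mul_im, zero_add]
  linear_combination (-(v k).im * φ (Pi.single k I)) * (I_sq : I ^ 2 = -1) * (-1)

theorem fderiv_fiber (f : Pt n → ℂ) (p : Pt n) (v : Fin n → ℂ) :
    fderiv ℝ f p (0, v) =
      ∑ k, (v k * cd (ve k) f p + (starRingEnd ℂ) (v k) * cd (veb k) f p) := by
  have := real_linear_single
    ((fderiv ℝ f p).comp (ContinuousLinearMap.inr ℝ (Fin n → ℂ) (Fin n → ℂ))) v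
  simpa [← de_eq, ← debar_eq, de, debar] using this

theorem fderiv_base (f : Pt n → ℂ) (p : Pt n) (v : Fin n → ℂ) :
    fderiv ℝ f p (v, 0) =
      ∑ k, (v k * cd (vz k) f p + (starRingEnd ℂ) (v k) * cd (vzb k) f p) := by
  have := real_linear_single
    ((fderiv ℝ f p).comp (ContinuousLinearMap.inl ℝ (Fin n → ℂ) (Fin n → ℂ))) v
  simpa [← dz_eq, ← dzbar_eq, dz, dzbar] using this

/-- A function all of whose Wirtinger derivatives vanish at `p` has zero derivative there. -/
theorem fderiv_eq_zero_of_cd (f : Pt n → ℂ) (p : Pt n) (h1 : ∀ k, cd (vz k) f p = 0)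
    (h2 : ∀ k, cd (vzb k) f p = 0) (h3 : ∀ k, cd (ve k) f p = 0)
    (h4 : ∀ k, cd (veb k) f p = 0) : fderiv ℝ f p = 0 := by
  refine ContinuousLinearMap.ext fun w => ?_
  have hw : w = (w.1, 0) + (0, w.2) := by simp
  rw [hw, map_add, fderiv_fiber, fderiv_base]
  simp [h1, h2, h3, h4]

end Frame

section Homogeneity

variable {n : ℕ} {D : Set (Pt n)} {L : Pt n → ℂ} {p : Pt n}

theorem IsCFM.fderiv_radial (hL : IsCFM n D L) (hp : p ∈ D) (c : ℂ) :
    fderiv ℝ L p (0, c • p.2) = (2 * c.re : ℝ) * L p := by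
  have hd : DifferentiableAt ℝ L p := Sm.differentiableAt hL.smooth hL.openD hp
  let γ : ℝ → Pt n := fun t => (p.1, (1 + (t : ℂ) * c) • p.2)
  have hγ : HasDerivAt γ (0, c • p.2) 0 := by
    have h1 : HasDerivAt (fun t : ℝ => 1 + (t : ℂ) * c) c 0 := by
      simpa using ((hasDerivAt_id (0 : ℝ)).ofReal_comp.mul_const c).const_add 1
    exact (hasDerivAt_const _ _).prodMk (h1.smul_const p.2)
  have hγ0 : γ 0 = p := by simp [γ]
  have h1 : HasDerivAt (L ∘ γ) (fderiv ℝ L p (0, c • p.2)) 0 := by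
    have : HasFDerivAt L (fderiv ℝ L p) (γ 0) := by rw [hγ0]; exact hd.hasFDerivAt
    exact this.comp_hasDerivAt 0 hγ
  have h2 : HasDerivAt (fun t : ℝ => ((normSq (1 + (t : ℂ) * c) : ℝ) : ℂ) * L p)
      ((2 * c.re : ℝ) * L p) 0 := by
    refine HasDerivAt.mul_const (HasDerivAt.ofReal_comp ?_) _
    have h3 : (fun t : ℝ => normSq (1 + (t : ℂ) * c)) =
        fun t : ℝ => 1 + (2 * c.re * t + normSq c * t ^ 2) := by
      funext t
      simp [normSq_apply]
      ring
    rw [h3]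
    have := (((hasDerivAt_id (0 : ℝ)).const_mul (2 * c.re)).add
      (((hasDerivAt_id (0 : ℝ)).pow 2).const_mul (normSq c))).const_add 1
    simpa using this
  refine h1.unique (h2.congr_of_eventuallyEq ?_)
  have hc : ContinuousAt (fun t : ℝ => 1 + (t : ℂ) * c) 0 := by fun_prop
  have hne : ∀ᶠ t : ℝ in nhds 0, 1 + (t : ℂ) * c ≠ 0 :=
    hc.eventually_ne (by simp)
  filter_upwards [hne] with t ht
  exact hL.homog p hp _ ht

theorem IsCFM.euler (hL : IsCFM n D L) (hp : p ∈ D) :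
    ∑ k, eta k p * cd (ve k) L p = L p ∧ ∑ k, etab k p * cd (veb k) L p = L p := by
  have h1 := hL.fderiv_radial hp 1
  have h2 := hL.fderiv_radial hp I
  rw [fderiv_fiber, Finset.sum_add_distrib] at h1 h2
  simp only [Pi.smul_apply, smul_eq_mul, map_mul, conj_I, mul_assoc, ← Finset.mul_sum,
    one_mul, one_re, I_re] at h1 h2
  simp only [eta, etab]
  push_cast at h1 h2
  constructor
  · linear_combination (1 / 2) * h1 - (I / 2) * h2 + (1 / 2) *
      (∑ k, p.2 k * cd (ve k) L p - ∑ k, (starRingEnd ℂ) (p.2 k) * cd (veb k) L p) * I_sq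
  · linear_combination (1 / 2) * h1 + (I / 2) * h2 - (1 / 2) *
      (∑ k, p.2 k * cd (ve k) L p - ∑ k, (starRingEnd ℂ) (p.2 k) * cd (veb k) L p) * I_sq

end Homogeneity
section Connection

variable {n : ℕ} {D : Set (Pt n)} {L : Pt n → ℂ} {p : Pt n}

namespace IsCFM

theorem sm_gm (hL : IsCFM n D L) (i j : Fin n) : Sm D (gm L i j) := by
  rw [gm_eq]
  exact (Sm.cd hL.smooth hL.openD _).cd hL.openD _

theorem sm_ve (hL : IsCFM n D L) (i : Fin n) : Sm D (cd (ve i) L) :=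
  Sm.cd hL.smooth hL.openD _

theorem sm_veb (hL : IsCFM n D L) (i : Fin n) : Sm D (cd (veb i) L) :=
  Sm.cd hL.smooth hL.openD _

theorem ne_zero (hL : IsCFM n D L) (hp : p ∈ D) : L p ≠ 0 := fun h => by
  simpa [h] using hL.pos p hp

theorem eta_gm (hL : IsCFM n D L) (m : Fin n) (hp : p ∈ D) :
    ∑ l, eta l p * gm L l m p = cd (veb m) L p := by
  have h := cd_congr hL.openD (fun q hq => (hL.euler hq).1) (veb m) hp
  rw [cd_sum_mul hL.openD (eta_smooth D) hL.sm_ve _ hp] at h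
  simpa [cd_comm hL.openD hL.smooth (veb m) _ hp, gm_eq] using h

theorem etab_gm (hL : IsCFM n D L) (i : Fin n) (hp : p ∈ D) :
    ∑ m, etab m p * gm L i m p = cd (ve i) L p := by
  have h := cd_congr hL.openD (fun q hq => (hL.euler hq).2) (ve i) hp
  rw [cd_sum_mul hL.openD (etab_smooth D) hL.sm_veb _ hp] at h
  simpa [gm_eq] using h

theorem eta_cd_ve (hL : IsCFM n D L) (k : Fin n) (hp : p ∈ D) :
    ∑ l, eta l p * cd (ve l) (cd (ve k) L) p = 0 := by
  have h := cd_congr hL.openD (fun q hq => (hL.euler hq).1) (ve k) hp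
  rw [cd_sum_mul hL.openD (eta_smooth D) hL.sm_ve _ hp] at h
  simpa [cd_comm hL.openD hL.smooth (ve k) _ hp, Finset.sum_add_distrib] using h

theorem eta_ve_gm (hL : IsCFM n D L) (k m : Fin n) (hp : p ∈ D) :
    ∑ l, eta l p * cd (ve k) (gm L l m) p = 0 := by
  have h := cd_congr hL.openD (fun q hq => hL.eta_gm m hq) (ve k) hp
  rw [cd_sum_mul hL.openD (eta_smooth D) (fun l => hL.sm_gm l m) _ hp, ← gm_eq] at h
  simpa [Finset.sum_add_distrib] using h

theorem etab_ve_gm (hL : IsCFM n D L) (i k : Fin n) (hp : p ∈ D) :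
    ∑ m, etab m p * cd (ve k) (gm L i m) p = cd (ve k) (cd (ve i) L) p := by
  have h := cd_congr hL.openD (fun q hq => hL.etab_gm i hq) (ve k) hp
  rw [cd_sum_mul hL.openD (etab_smooth D) (fun l => hL.sm_gm i l) _ hp] at h
  simpa [Finset.sum_add_distrib] using h

theorem eta_vz_gm (hL : IsCFM n D L) (k m : Fin n) (hp : p ∈ D) :
    ∑ l, eta l p * cd (vz k) (gm L l m) p = cd (vz k) (cd (veb m) L) p := by
  have h := cd_congr hL.openD (fun q hq => hL.eta_gm m hq) (vz k) hp
  rw [cd_sum_mul hL.openD (eta_smooth D) (fun l => hL.sm_gm l m) _ hp] at h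
  simpa [Finset.sum_add_distrib] using h

theorem etab_vz_veb (hL : IsCFM n D L) (k : Fin n) (hp : p ∈ D) :
    ∑ m, etab m p * cd (vz k) (cd (veb m) L) p = cd (vz k) L p := by
  have h := cd_congr hL.openD (fun q hq => (hL.euler hq).2) (vz k) hp
  rw [cd_sum_mul hL.openD (etab_smooth D) hL.sm_veb _ hp] at h
  simpa [Finset.sum_add_distrib] using h

theorem ve_gm_symm (hL : IsCFM n D L) (k l m : Fin n) (hp : p ∈ D) :
    cd (ve k) (gm L l m) p = cd (ve l) (gm L k m) p := by
  rw [gm_eq, gm_eq, cd_comm hL.openD (hL.sm_veb m) _ _ hp]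

theorem det_ne_zero (hL : IsCFM n D L) (hp : p ∈ D) : (gmat L p).det ≠ 0 := by
  intro h
  obtain ⟨v, hv, h0⟩ := Matrix.exists_vecMul_eq_zero_iff.2 h
  have hpos := hL.posdef p hp v hv
  rw [Finset.sum_comm] at hpos
  have : ∀ j, ∑ i, gm L i j p * v i * (starRingEnd ℂ) (v j) = 0 := fun j => by
    rw [← Finset.sum_mul]
    have hj : ∑ i, v i * gm L i j p = 0 := congrFun h0 j
    simp only [mul_comm (v _)] at hj
    rw [hj, zero_mul]
  simp [this] at hpos

theorem gi_gm (hL : IsCFM n D L) (hp : p ∈ D) (i j : Fin n) :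
    ∑ l, gi L i l p * gm L l j p = if i = j then 1 else 0 := by
  have h := Matrix.nonsing_inv_mul (gmat L p) (hL.det_ne_zero hp).isUnit
  rw [← Matrix.one_apply, ← h, Matrix.mul_apply]
  rfl

/-- Lowering an index that was raised with the inverse metric. -/
theorem lower_raise (hL : IsCFM n D L) (hp : p ∈ D) (a : Fin n → ℂ) (m : Fin n) :
    ∑ i, (∑ l, gi L l i p * a l) * gm L i m p = a m := by
  simp only [Finset.sum_mul]
  rw [Finset.sum_comm]
  have : ∀ l, ∑ i, gi L l i p * a l * gm L i m p = a l * if l = m then 1 else 0 := fun l => by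
    rw [← hL.gi_gm hp, Finset.mul_sum]
    exact Finset.sum_congr rfl fun _ _ => by ring
  simp [this]

/-- The metric tensor is nondegenerate. -/
theorem cancel (hL : IsCFM n D L) (hp : p ∈ D) {a b : Fin n → ℂ}
    (h : ∀ m, ∑ i, a i * gm L i m p = ∑ i, b i * gm L i m p) (i : Fin n) : a i = b i := by
  have h' : Matrix.vecMul a (gmat L p) = Matrix.vecMul b (gmat L p) := funext h
  have := congrArg (fun v => Matrix.vecMul v (gmat L p)⁻¹) h'
  simp only [Matrix.vecMul_vecMul, Matrix.mul_nonsing_inv _ (hL.det_ne_zero hp).isUnit,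
    Matrix.vecMul_one] at this
  exact congrFun this i

theorem Nc_gm (hL : IsCFM n D L) (k m : Fin n) (hp : p ∈ D) :
    ∑ i, Nc L i k p * gm L i m p = cd (vz k) (cd (veb m) L) p := by
  rw [← hL.lower_raise hp (fun m => cd (vz k) (cd (veb m) L) p) m]
  refine Finset.sum_congr rfl fun i _ => congrArg (· * _) (Finset.sum_congr rfl fun l _ => ?_)
  rw [← hL.eta_vz_gm k l hp, Finset.mul_sum]
  exact Finset.sum_congr rfl fun j _ => by rw [dz_eq, eta]; ring

theorem Lc_gm (hL : IsCFM n D L) (j k m : Fin n) (hp : p ∈ D) :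
    ∑ i, Lc L i j k p * gm L i m p =
      cd (vz k) (gm L j m) p - ∑ i, Nc L i k p * cd (ve i) (gm L j m) p := by
  have h := hL.lower_raise hp (fun m => del L (gm L j m) k p) m
  rw [del, dz_eq] at h
  simpa only [Lc, de_eq] using h

theorem Cc_gm (hL : IsCFM n D L) (j k m : Fin n) (hp : p ∈ D) :
    ∑ i, Cc L i j k p * gm L i m p = cd (ve k) (gm L j m) p := by
  rw [← de_eq]
  exact hL.lower_raise hp (fun m => de (gm L j m) k p) m

theorem Cc_symm (hL : IsCFM n D L) (i j k : Fin n) (hp : p ∈ D) :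
    Cc L i j k p = Cc L i k j p :=
  Finset.sum_congr rfl fun l _ => by rw [de_eq, de_eq, hL.ve_gm_symm k j l hp]

theorem eta_Cc (hL : IsCFM n D L) (i k : Fin n) (hp : p ∈ D) :
    ∑ j, eta j p * Cc L i j k p = 0 := by
  simp only [Cc, Finset.mul_sum]
  rw [Finset.sum_comm]
  refine Finset.sum_eq_zero fun l _ => ?_
  rw [← mul_zero (gi L l i p), ← hL.eta_ve_gm k l hp, Finset.mul_sum]
  exact Finset.sum_congr rfl fun j _ => by rw [de_eq]; ring

theorem Cc_ve (hL : IsCFM n D L) (j k : Fin n) (hp : p ∈ D) :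
    ∑ i, Cc L i j k p * cd (ve i) L p = cd (ve k) (cd (ve j) L) p := by
  rw [← hL.etab_ve_gm j k hp]
  simp only [← hL.etab_gm _ hp, ← hL.Cc_gm j k _ hp, Finset.mul_sum]
  rw [Finset.sum_comm]
  exact Finset.sum_congr rfl fun _ _ => Finset.sum_congr rfl fun _ _ => by ring

theorem eta_Lc (hL : IsCFM n D L) (i k : Fin n) (hp : p ∈ D) :
    ∑ j, eta j p * Lc L i j k p = Nc L i k p := by
  refine hL.cancel hp (a := fun i => ∑ j, eta j p * Lc L i j k p)
    (b := fun i => Nc L i k p) (fun m => ?_) i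
  rw [hL.Nc_gm k m hp, ← hL.eta_vz_gm k m hp]
  simp only [Finset.sum_mul]
  rw [Finset.sum_comm]
  have h : ∀ j, ∑ i, eta j p * Lc L i j k p * gm L i m p = eta j p * cd (vz k) (gm L j m) p -
      ∑ i, Nc L i k p * (eta j p * cd (ve i) (gm L j m) p) := fun j => by
    have := congrArg (eta j p * ·) (hL.Lc_gm j k m hp)
    simp only [mul_sub, Finset.mul_sum] at this
    simp only [mul_assoc, this]
    congr 1
    exact Finset.sum_congr rfl fun _ _ => by ring
  simp only [h, Finset.sum_sub_distrib]
  rw [Finset.sum_comm (f := fun j i => Nc L i k p * (eta j p * cd (ve i) (gm L j m) p))]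
  simp [← Finset.mul_sum, hL.eta_ve_gm _ m hp]

end IsCFM

end Connection

section Surface

variable {D : Set (Pt 2)} {L : Pt 2 → ℂ} {p : Pt 2}

namespace IsCFM

theorem sm_gi (hL : IsCFM 2 D L) (l i : Fin 2) : Sm D (gi L l i) := by
  have hdet : Sm D (fun q => (gmat L q).det) := by
    simp only [Matrix.det_fin_two, gmat]
    exact ((hL.sm_gm 0 0).mul (hL.sm_gm 1 1)).sub ((hL.sm_gm 0 1).mul (hL.sm_gm 1 0))
  have hinv := ContDiffOn.inv hdet fun q hq => hL.det_ne_zero hq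
  have hadj : Sm D (fun q => (gmat L q).adjugate l i) := by
    simp only [Matrix.adjugate_fin_two, gmat]
    fin_cases l <;> fin_cases i <;> simp [hL.sm_gm, ContDiffOn.neg]
  have : gi L l i = fun q => ((gmat L q).det)⁻¹ * (gmat L q).adjugate l i := by
    funext q
    simp [gi, Matrix.inv_def]
  rw [this]
  exact hinv.mul hadj

theorem sm_Nc (hL : IsCFM 2 D L) (i k : Fin 2) : Sm D (Nc L i k) := by
  refine ContDiffOn.sum fun m _ => ContDiffOn.sum fun l _ => ?_
  rw [dz_eq]
  exact ((hL.sm_gi m i).mul ((hL.sm_gm l m).cd hL.openD _)).mul (eta_smooth D l)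

theorem Lc_eq (hL : IsCFM 2 D L) (i j k : Fin 2) (hp : p ∈ D) :
    Lc L i j k p = cd (ve j) (Nc L i k) p := by
  refine hL.cancel hp (a := fun i => Lc L i j k p)
    (b := fun i => cd (ve j) (Nc L i k) p) (fun m => ?_) i
  have h := cd_congr hL.openD (fun q hq => hL.Nc_gm k m hq) (ve j) hp
  rw [cd_sum_mul hL.openD (fun i => hL.sm_Nc i k) (fun i => hL.sm_gm i m) _ hp,
    cd_comm hL.openD (hL.sm_veb m) _ _ hp, ← gm_eq, Finset.sum_add_distrib] at h
  simp only [hL.ve_gm_symm j _ m hp] at h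
  rw [hL.Lc_gm j k m hp, ← h]
  ring

theorem sm_Lc (hL : IsCFM 2 D L) (i j k : Fin 2) : Sm D (Lc L i j k) :=
  ((hL.sm_Nc i k).cd hL.openD (ve j)).congr fun _ hq => hL.Lc_eq i j k hq

theorem Nc_ve (hL : IsCFM 2 D L) (k : Fin 2) (hp : p ∈ D) :
    ∑ i, Nc L i k p * cd (ve i) L p = cd (vz k) L p := by
  rw [← hL.etab_vz_veb k hp]
  simp only [← hL.etab_gm _ hp, ← hL.Nc_gm k _ hp, Finset.mul_sum]
  rw [Finset.sum_comm]
  exact Finset.sum_congr rfl fun _ _ => Finset.sum_congr rfl fun _ _ => by ring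

theorem veb_Nc_ve (hL : IsCFM 2 D L) (l k : Fin 2) (hp : p ∈ D) :
    ∑ i, cd (veb l) (Nc L i k) p * cd (ve i) L p = 0 := by
  have h := cd_congr hL.openD (fun q hq => hL.Nc_ve k hq) (veb l) hp
  rw [cd_sum_mul hL.openD (fun i => hL.sm_Nc i k) hL.sm_ve _ hp,
    cd_comm hL.openD hL.smooth _ _ hp, ← hL.Nc_gm k l hp, Finset.sum_add_distrib] at h
  simpa [cd_comm hL.openD hL.smooth (veb l) _ hp, gm_eq] using h

theorem sm_conj_Nc (hL : IsCFM 2 D L) (i k : Fin 2) :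
    Sm D (fun q => (starRingEnd ℂ) (Nc L i k q)) :=
  (conjCLE : ℂ →L[ℝ] ℂ).contDiff.comp_contDiffOn (hL.sm_Nc i k)

end IsCFM

theorem delbar_eq (f : Pt 2 → ℂ) (k : Fin 2) :
    delbar L f k = fun q => cd (vzb k) f q +
      ∑ j, (starRingEnd ℂ) (Nc L j k q) * ((-1) * cd (veb j) f q) := by
  funext q
  simp [delbar, dzbar_eq, debar_eq, sub_eq_add_neg]

namespace IsCFM

theorem delbar_congr (hL : IsCFM 2 D L) {f g : Pt 2 → ℂ} (h : ∀ q ∈ D, f q = g q) (k : Fin 2)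
    (hp : p ∈ D) : delbar L f k p = delbar L g k p := by
  simp only [delbar_eq, cd_congr hL.openD h _ hp]

theorem sm_neg_cd (hL : IsCFM 2 D L) {f : Pt 2 → ℂ} (hf : Sm D f) (X : Pt 2 × Pt 2) :
    Sm D (fun q => (-1) * cd X f q) :=
  contDiffOn_const.mul (hf.cd hL.openD X)

/-- The commutator of the vertical derivation `∂/∂η^j` with `δ_h̄`. -/
theorem cd_ve_delbar (hL : IsCFM 2 D L) {f : Pt 2 → ℂ} (hf : Sm D f) (j h : Fin 2)
    (hp : p ∈ D) :
    cd (ve j) (delbar L f h) p = delbar L (cd (ve j) f) h p -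
      ∑ l, cd (ve j) (fun q => (starRingEnd ℂ) (Nc L l h q)) p * cd (veb l) f p := by
  have hs : ∀ l, Sm D (fun q => (-1) * cd (veb l) f q) := fun l => hL.sm_neg_cd hf _
  have hn : ∀ l, cd (ve j) (fun q => (-1) * cd (veb l) f q) p =
      -cd (veb l) (cd (ve j) f) p := fun l => by
    rw [cd_mul hL.openD contDiffOn_const (hf.cd hL.openD _) _ hp, cd_const,
      cd_comm hL.openD hf _ _ hp]
    ring
  rw [delbar_eq, delbar_eq, cd_add hL.openD (hf.cd hL.openD _)
      (ContDiffOn.sum fun l _ => (hL.sm_conj_Nc l h).mul (hs l)) _ hp,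
    cd_sum_mul hL.openD (fun l => hL.sm_conj_Nc l h) hs _ hp, cd_comm hL.openD hf _ _ hp]
  simp only [hn, Fin.sum_univ_two]
  ring

theorem delbar_sum_eta (hL : IsCFM 2 D L) {f : Fin 2 → Pt 2 → ℂ} (hf : ∀ i, Sm D (f i))
    (h : Fin 2) (hp : p ∈ D) :
    delbar L (fun q => ∑ j, eta j q * f j q) h p = ∑ j, eta j p * delbar L (f j) h p := by
  simp only [delbar_eq]
  simp only [cd_sum_mul hL.openD (eta_smooth D) hf _ hp, cd_vzb_eta, cd_veb_eta]
  simp only [Fin.sum_univ_two]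
  ring

end IsCFM

/-- The Kronecker symbol. -/
def kd (i j : Fin 2) : ℂ := if i = j then 1 else 0

theorem sum_mul_kd (a : Fin 2 → ℂ) (k : Fin 2) : ∑ i, a i * kd i k = a k := by
  simp [kd]

theorem sum_mul_kd' (a : Fin 2 → ℂ) (k : Fin 2) : ∑ i, a i * kd k i = a k := by
  simp [kd]

/-- The curvature condition `R_{r̄jh̄k} = κ (g_{jr̄} g_{kh̄} + g_{kr̄} g_{jh̄})`. -/
def HasConstHolCurv (D : Set (Pt 2)) (L κ : Pt 2 → ℂ) : Prop :=
  ∀ p ∈ D, ∀ r j h k : Fin 2, Rh L r j h k p =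
      κ p * (gm L j r p * gm L k h p + gm L k r p * gm L j h p)

namespace IsCFM

variable {κ : Pt 2 → ℂ}

theorem raised_curvature (hL : IsCFM 2 D L) (hR : HasConstHolCurv D L κ) (i j h k : Fin 2)
    (hp : p ∈ D) :
    -(delbar L (Lc L i j k) h p) - ∑ l, delbar L (Nc L l k) h p * Cc L i j l p =
      κ p * (kd i j * gm L k h p + kd i k * gm L j h p) := by
  refine hL.cancel hp
    (a := fun i => -(delbar L (Lc L i j k) h p) - ∑ l, delbar L (Nc L l k) h p * Cc L i j l p)
    (b := fun i => κ p * (kd i j * gm L k h p + kd i k * gm L j h p)) (fun r => ?_) i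
  have h1 := hR p hp r j h k
  have h2 := sum_mul_kd (fun i => gm L i r p) j
  have h3 := sum_mul_kd (fun i => gm L i r p) k
  simp only [Rh, Fin.sum_univ_two] at h1 h2 h3 ⊢
  linear_combination h1 - κ p * gm L k h p * h2 - κ p * gm L j h p * h3

theorem delbar_Nc (hL : IsCFM 2 D L) (hR : HasConstHolCurv D L κ) (i h k : Fin 2)
    (hp : p ∈ D) :
    delbar L (Nc L i k) h p =
      (-1) * κ p * (eta i p * gm L k h p + kd i k * cd (veb h) L p) := by
  have h1 := hL.delbar_congr (fun q hq => hL.eta_Lc i k hq) h hp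
  rw [hL.delbar_sum_eta (fun j => hL.sm_Lc i j k) h hp] at h1
  have h2 := sum_mul_kd' (fun j => eta j p) i
  have h3 := hL.eta_gm h hp
  have h4 := hL.raised_curvature hR i 0 h k hp
  have h5 := hL.raised_curvature hR i 1 h k hp
  have h6 := hL.eta_Cc i 0 hp
  have h7 := hL.eta_Cc i 1 hp
  simp only [Fin.sum_univ_two] at h1 h2 h3 h4 h5 h6 h7
  linear_combination -h1 - eta 0 p * h4 - eta 1 p * h5 - delbar L (Nc L 0 k) h p * h6
    - delbar L (Nc L 1 k) h p * h7 - κ p * gm L k h p * h2 - κ p * kd i k * h3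

theorem delbar_Lc (hL : IsCFM 2 D L) (hR : HasConstHolCurv D L κ) (i j h k : Fin 2)
    (hp : p ∈ D) :
    delbar L (Lc L i j k) h p =
      κ p * (Cc L i j k p * cd (veb h) L p - kd i j * gm L k h p - kd i k * gm L j h p) := by
  have h1 := hL.raised_curvature hR i j h k hp
  have h2 := hL.eta_Cc i j hp
  have h3 := sum_mul_kd (fun l => Cc L i j l p) k
  simp only [hL.delbar_Nc hR _ _ _ hp, hL.Cc_symm i _ j hp, Fin.sum_univ_two] at h1 h2 h3
  linear_combination -h1 + κ p * gm L k h p * h2 + κ p * cd (veb h) L p * h3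

theorem cd_rhs (hL : IsCFM 2 D L) (hκ : Sm D κ) (i h k : Fin 2) (X : Pt 2 × Pt 2) (hp : p ∈ D) :
    cd X (fun q => (-1) * κ q * (eta i q * gm L k h q + kd i k * cd (veb h) L q)) p =
      -cd X κ p * (eta i p * gm L k h p + kd i k * cd (veb h) L p) -
      κ p * (cd X (eta i) p * gm L k h p + eta i p * cd X (gm L k h) p +
        kd i k * cd X (cd (veb h) L) p) := by
  have hD := hL.openD
  have h1 : Sm D (fun q => eta i q * gm L k h q) := (eta_smooth D i).mul (hL.sm_gm k h)
  have h2 : Sm D (fun q => kd i k * cd (veb h) L q) := contDiffOn_const.mul (hL.sm_veb h)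
  have h3 : Sm D (fun q => (-1) * κ q) := contDiffOn_const.mul hκ
  rw [cd_mul hD h3 (h1.add h2) _ hp, cd_mul hD contDiffOn_const hκ _ hp, cd_add hD h1 h2 _ hp,
    cd_mul hD (eta_smooth D i) (hL.sm_gm k h) _ hp,
    cd_mul hD contDiffOn_const (hL.sm_veb h) _ hp, cd_const, cd_const]
  ring

/-- A contracted Bianchi identity: the vertical derivative of `δ_h̄ N^i_k`, contracted
with `∂L/∂η^i`. -/
theorem vertical_bianchi (hL : IsCFM 2 D L) (hκ : Sm D κ) (hR : HasConstHolCurv D L κ)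
    (j h k : Fin 2) (hp : p ∈ D) :
    κ p * (cd (ve k) (cd (ve j) L) p * cd (veb h) L p + L p * cd (ve j) (gm L k h) p) =
      -cd (ve j) κ p * (L p * gm L k h p + cd (ve k) L p * cd (veb h) L p) := by
  have key : ∀ i, κ p * (Cc L i j k p * cd (veb h) L p + eta i p * cd (ve j) (gm L k h) p) -
      ∑ l, cd (ve j) (fun q => (starRingEnd ℂ) (Nc L l h q)) p * cd (veb l) (Nc L i k) p =
      -cd (ve j) κ p * (eta i p * gm L k h p + kd i k * cd (veb h) L p) := fun i => by
    have h1 := cd_congr hL.openD (fun q hq => hL.delbar_Nc hR i h k hq) (ve j) hp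
    rw [hL.cd_ve_delbar (hL.sm_Nc i k) j h hp,
      hL.delbar_congr (fun q hq => (hL.Lc_eq i j k hq).symm) h hp, hL.delbar_Lc hR i j h k hp,
      hL.cd_rhs hκ i h k _ hp, cd_ve_eta, ← gm_eq] at h1
    rw [← kd] at h1
    linear_combination h1
  have k0 := key 0
  have k1 := key 1
  have h1 := hL.Cc_ve j k hp
  have h2 := (hL.euler hp).1
  have h3 := sum_mul_kd (fun i => cd (ve i) L p) k
  have h4 := hL.veb_Nc_ve 0 k hp
  have h5 := hL.veb_Nc_ve 1 k hp
  simp only [Fin.sum_univ_two] at k0 k1 h1 h2 h3 h4 h5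
  linear_combination cd (ve 0) L p * k0 + cd (ve 1) L p * k1 - κ p * cd (veb h) L p * h1
    - (κ p * cd (ve j) (gm L k h) p + cd (ve j) κ p * gm L k h p) * h2
    - cd (ve j) κ p * cd (veb h) L p * h3
    + cd (ve j) (fun q => (starRingEnd ℂ) (Nc L 0 h q)) p * h4
    + cd (ve j) (fun q => (starRingEnd ℂ) (Nc L 1 h q)) p * h5

theorem vertical_bianchi_contracted (hL : IsCFM 2 D L) (hκ : Sm D κ)
    (hR : HasConstHolCurv D L κ) (j k : Fin 2) (hp : p ∈ D) :
    κ p * cd (ve k) (cd (ve j) L) p = -cd (ve j) κ p * cd (ve k) L p := by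
  have b0 := hL.vertical_bianchi hκ hR j 0 k hp
  have b1 := hL.vertical_bianchi hκ hR j 1 k hp
  have h1 := (hL.euler hp).2
  have h2 := hL.etab_gm k hp
  have h3 := hL.etab_ve_gm k j hp
  rw [cd_comm hL.openD hL.smooth _ _ hp] at h3
  simp only [Fin.sum_univ_two] at h1 h2 h3
  have : 2 * L p * (κ p * cd (ve k) (cd (ve j) L) p) =
      2 * L p * (-cd (ve j) κ p * cd (ve k) L p) := by
    linear_combination etab 0 p * b0 + etab 1 p * b1
      - (κ p * cd (ve k) (cd (ve j) L) p + cd (ve j) κ p * cd (ve k) L p) * h1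
      - cd (ve j) κ p * L p * h2 - κ p * L p * h3
  exact mul_left_cancel₀ (mul_ne_zero two_ne_zero (hL.ne_zero hp)) this

theorem ve_curvature (hL : IsCFM 2 D L) (hκ : Sm D κ)
    (hR : HasConstHolCurv D L κ) (j : Fin 2) (hp : p ∈ D) : cd (ve j) κ p = 0 := by
  have b0 := hL.vertical_bianchi_contracted hκ hR j 0 hp
  have b1 := hL.vertical_bianchi_contracted hκ hR j 1 hp
  have h1 := (hL.euler hp).1
  have h2 := hL.eta_cd_ve j hp
  simp only [Fin.sum_univ_two] at h1 h2
  have : cd (ve j) κ p * L p = 0 := by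
    linear_combination eta 0 p * b0 + eta 1 p * b1 - cd (ve j) κ p * h1 - κ p * h2
  exact (mul_eq_zero.1 this).resolve_right (hL.ne_zero hp)

theorem ve_ve_eq_zero (hL : IsCFM 2 D L) (hκ : Sm D κ) (hκ0 : ∀ q ∈ D, κ q ≠ 0)
    (hR : HasConstHolCurv D L κ) (j k : Fin 2) (hp : p ∈ D) :
    cd (ve k) (cd (ve j) L) p = 0 := by
  have := hL.vertical_bianchi_contracted hκ hR j k hp
  rw [hL.ve_curvature hκ hR j hp, neg_zero, zero_mul] at this
  exact (mul_eq_zero.1 this).resolve_left (hκ0 p hp)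

theorem ve_gm_eq_zero (hL : IsCFM 2 D L) (hκ : Sm D κ) (hκ0 : ∀ q ∈ D, κ q ≠ 0)
    (hR : HasConstHolCurv D L κ) (j k m : Fin 2) (hp : p ∈ D) :
    cd (ve k) (gm L j m) p = 0 := by
  have h := cd_congr hL.openD (fun q hq => hL.ve_ve_eq_zero hκ hκ0 hR j k hq) (veb m) hp
  rw [cd_const, cd_comm hL.openD (hL.sm_ve j) _ _ hp] at h
  rw [← h]
  refine cd_congr hL.openD (fun q hq => ?_) _ hp
  rw [gm_eq, cd_comm hL.openD hL.smooth _ _ hq]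

theorem conj_cd_ve (hL : IsCFM 2 D L) {f g : Pt 2 → ℂ} (hf : Sm D f)
    (hfg : ∀ q ∈ D, (starRingEnd ℂ) (f q) = g q) (k : Fin 2) (hp : p ∈ D) :
    (starRingEnd ℂ) (cd (ve k) f p) = cd (veb k) g p := by
  rw [conj_cd (hf.differentiableAt hL.openD hp), cd_congr hL.openD hfg _ hp]
  congr 1
  simp [ve, veb, neg_div]

theorem conj_cd_vz (hL : IsCFM 2 D L) {f g : Pt 2 → ℂ} (hf : Sm D f)
    (hfg : ∀ q ∈ D, (starRingEnd ℂ) (f q) = g q) (k : Fin 2) (hp : p ∈ D) :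
    (starRingEnd ℂ) (cd (vz k) f p) = cd (vzb k) g p := by
  rw [conj_cd (hf.differentiableAt hL.openD hp), cd_congr hL.openD hfg _ hp]
  congr 1
  simp [vz, vzb, neg_div]

theorem veb_veb_eq_zero (hL : IsCFM 2 D L) (hκ : Sm D κ) (hκ0 : ∀ q ∈ D, κ q ≠ 0)
    (hR : HasConstHolCurv D L κ) (j k : Fin 2) (hp : p ∈ D) :
    cd (veb k) (cd (veb j) L) p = 0 := by
  have h : ∀ q ∈ D, (starRingEnd ℂ) (cd (ve j) L q) = cd (veb j) L q := fun q hq =>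
    hL.conj_cd_ve hL.smooth (fun x hx => conj_eq_iff_im.2 (hL.real_im x hx)) j hq
  rw [← hL.conj_cd_ve (hL.sm_ve j) h k hp, hL.ve_ve_eq_zero hκ hκ0 hR j k hp, map_zero]

theorem veb_Nc_eq_zero (hL : IsCFM 2 D L) (hκ : Sm D κ) (hκ0 : ∀ q ∈ D, κ q ≠ 0)
    (hR : HasConstHolCurv D L κ) (i k s : Fin 2) (hp : p ∈ D) :
    cd (veb s) (Nc L i k) p = 0 := by
  refine hL.cancel hp (a := fun i => cd (veb s) (Nc L i k) p) (b := fun _ => 0) (fun m => ?_) i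
  have h := cd_congr hL.openD (fun q hq => hL.Nc_gm k m hq) (veb s) hp
  have h1 : ∀ q ∈ D, cd (veb s) (cd (veb m) L) q = 0 := fun q hq =>
    hL.veb_veb_eq_zero hκ hκ0 hR m s hq
  have h2 : ∀ i, cd (veb s) (gm L i m) p = 0 := fun i => by
    rw [gm_eq, cd_comm hL.openD (hL.sm_veb m) _ _ hp, cd_congr hL.openD h1 _ hp, cd_const]
  rw [cd_sum_mul hL.openD (fun i => hL.sm_Nc i k) (fun i => hL.sm_gm i m) _ hp,
    cd_comm hL.openD (hL.sm_veb m) _ _ hp, cd_congr hL.openD h1 _ hp, cd_const] at h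
  simpa [h2] using h

theorem vzb_Nc (hL : IsCFM 2 D L) (hκ : Sm D κ) (hκ0 : ∀ q ∈ D, κ q ≠ 0)
    (hR : HasConstHolCurv D L κ) (i h k : Fin 2) (hp : p ∈ D) :
    cd (vzb h) (Nc L i k) p =
      (-1) * κ p * (eta i p * gm L k h p + kd i k * cd (veb h) L p) := by
  rw [← hL.delbar_Nc hR i h k hp, delbar_eq]
  simp [hL.veb_Nc_eq_zero hκ hκ0 hR i k _ hp]

theorem vz_gm (hL : IsCFM 2 D L) (hκ : Sm D κ) (hκ0 : ∀ q ∈ D, κ q ≠ 0)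
    (hR : HasConstHolCurv D L κ) (j k m : Fin 2) (hp : p ∈ D) :
    cd (vz k) (gm L j m) p = ∑ i, Lc L i j k p * gm L i m p := by
  rw [hL.Lc_gm j k m hp]
  simp [hL.ve_gm_eq_zero hκ hκ0 hR j _ m hp]

theorem vzb_Lc (hL : IsCFM 2 D L) (hκ : Sm D κ) (hκ0 : ∀ q ∈ D, κ q ≠ 0)
    (hR : HasConstHolCurv D L κ) (i j h k : Fin 2) (hp : p ∈ D) :
    cd (vzb h) (Lc L i j k) p = -κ p * (kd i j * gm L k h p + kd i k * gm L j h p) := by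
  rw [cd_congr hL.openD (fun q hq => hL.Lc_eq i j k hq) _ hp,
    cd_comm hL.openD (hL.sm_Nc i k) _ _ hp,
    cd_congr hL.openD (fun q hq => hL.vzb_Nc hκ hκ0 hR i h k hq) _ hp,
    hL.cd_rhs hκ i h k _ hp, cd_ve_eta, ← gm_eq, hL.ve_gm_eq_zero hκ hκ0 hR k j h hp,
    hL.ve_curvature hκ hR j hp, ← kd]
  ring

/-- The horizontal derivations `δ_k` and `δ_l` commute. -/
theorem vz_Nc_antisymm (hL : IsCFM 2 D L) (hκ : Sm D κ) (hκ0 : ∀ q ∈ D, κ q ≠ 0)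
    (hR : HasConstHolCurv D L κ) (i k l : Fin 2) (hp : p ∈ D) :
    cd (vz l) (Nc L i k) p + ∑ j, Nc L j k p * Lc L i j l p =
      cd (vz k) (Nc L i l) p + ∑ j, Nc L j l p * Lc L i j k p := by
  refine hL.cancel hp
    (a := fun i => cd (vz l) (Nc L i k) p + ∑ j, Nc L j k p * Lc L i j l p)
    (b := fun i => cd (vz k) (Nc L i l) p + ∑ j, Nc L j l p * Lc L i j k p) (fun m => ?_) i
  have key : ∀ k l, ∑ i, (cd (vz l) (Nc L i k) p + ∑ j, Nc L j k p * Lc L i j l p) *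
      gm L i m p = cd (vz l) (cd (vz k) (cd (veb m) L)) p := fun k l => by
    rw [← cd_congr hL.openD (fun q hq => hL.Nc_gm k m hq) (vz l) hp,
      cd_sum_mul hL.openD (fun i => hL.sm_Nc i k) (fun i => hL.sm_gm i m) _ hp]
    simp only [hL.vz_gm hκ hκ0 hR _ l m hp, Fin.sum_univ_two]
    ring
  rw [key, key, cd_comm hL.openD (hL.sm_veb m) _ _ hp]

/-- The horizontal Bianchi identity relating the derivative of the curvature to the torsion. -/
theorem horizontal_bianchi (hL : IsCFM 2 D L) (hκ : Sm D κ) (hκ0 : ∀ q ∈ D, κ q ≠ 0)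
    (hR : HasConstHolCurv D L κ) (i h k l : Fin 2) (hp : p ∈ D) :
    cd (vz k) κ p * (eta i p * gm L l h p + kd i l * cd (veb h) L p) -
      cd (vz l) κ p * (eta i p * gm L k h p + kd i k * cd (veb h) L p) +
      κ p * (eta i p * ∑ m, (Lc L m l k p - Lc L m k l p) * gm L m h p +
        cd (veb h) L p * (Lc L i l k p - Lc L i k l p)) = 0 := by
  have hD := hL.openD
  have hsum : ∀ k l, Sm D (fun q => ∑ j, Nc L j k q * Lc L i j l q) := fun k l =>
    ContDiffOn.sum fun j _ => (hL.sm_Nc j k).mul (hL.sm_Lc i j l)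
  have h1 := cd_congr hD (fun q hq => hL.vz_Nc_antisymm hκ hκ0 hR i k l hq) (vzb h) hp
  have h2 : ∀ k l, cd (vzb h)
      (fun q => cd (vz l) (Nc L i k) q + ∑ j, Nc L j k q * Lc L i j l q) p =
      -cd (vz l) κ p * (eta i p * gm L k h p + kd i k * cd (veb h) L p) -
      κ p * (eta i p * ∑ m, Lc L m k l p * gm L m h p + kd i k * ∑ m, Nc L m l p * gm L m h p) +
      ∑ j, ((-1) * κ p * (eta j p * gm L k h p + kd j k * cd (veb h) L p) * Lc L i j l p +
        Nc L j k p * (-κ p * (kd i j * gm L l h p + kd i l * gm L j h p))) := fun k l => by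
    rw [cd_add hD ((hL.sm_Nc i k).cd hD _) (hsum k l) _ hp,
      cd_sum_mul hD (fun j => hL.sm_Nc j k) (fun j => hL.sm_Lc i j l) _ hp,
      cd_comm hD (hL.sm_Nc i k) _ _ hp,
      cd_congr hD (fun q hq => hL.vzb_Nc hκ hκ0 hR i h k hq) _ hp, hL.cd_rhs hκ i h k _ hp,
      cd_vz_eta, hL.vz_gm hκ hκ0 hR k l h hp, ← hL.Nc_gm l h hp]
    simp only [hL.vzb_Nc hκ hκ0 hR _ h _ hp, hL.vzb_Lc hκ hκ0 hR _ _ h _ hp]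
    ring
  rw [h2, h2] at h1
  have e1 := hL.eta_Lc i k hp
  have e2 := hL.eta_Lc i l hp
  have d1 := sum_mul_kd' (fun j => Nc L j k p) i
  have d2 := sum_mul_kd' (fun j => Nc L j l p) i
  have d3 := sum_mul_kd (fun j => Lc L i j k p) l
  have d4 := sum_mul_kd (fun j => Lc L i j l p) k
  simp only [Fin.sum_univ_two] at h1 e1 e2 d1 d2 d3 d4 ⊢
  linear_combination h1 - κ p * gm L l h p * e1 + κ p * gm L k h p * e2
    + κ p * gm L l h p * d1 - κ p * gm L k h p * d2
    - κ p * cd (veb h) L p * d3 + κ p * cd (veb h) L p * d4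

theorem horizontal_bianchi_contracted (hL : IsCFM 2 D L) (hκ : Sm D κ)
    (hκ0 : ∀ q ∈ D, κ q ≠ 0) (hR : HasConstHolCurv D L κ) (i k l : Fin 2) (hp : p ∈ D) :
    cd (vz k) κ p * (eta i p * cd (ve l) L p + kd i l * L p) -
      cd (vz l) κ p * (eta i p * cd (ve k) L p + kd i k * L p) +
      κ p * (eta i p * ∑ m, (Lc L m l k p - Lc L m k l p) * cd (ve m) L p +
        L p * (Lc L i l k p - Lc L i k l p)) = 0 := by
  have b0 := hL.horizontal_bianchi hκ hκ0 hR i 0 k l hp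
  have b1 := hL.horizontal_bianchi hκ hκ0 hR i 1 k l hp
  have h1 := (hL.euler hp).2
  simp only [← hL.etab_gm _ hp, ← h1, Fin.sum_univ_two] at b0 b1 ⊢
  linear_combination etab 0 p * b0 + etab 1 p * b1

theorem torsion_eq_zero (hL : IsCFM 2 D L) (hκ : Sm D κ) (hκ0 : ∀ q ∈ D, κ q ≠ 0)
    (hR : HasConstHolCurv D L κ) (hc : ∀ k, cd (vz k) κ p = 0) (i k l : Fin 2) (hp : p ∈ D) :
    Lc L i l k p = Lc L i k l p := by
  have key : ∀ i, eta i p * ∑ m, (Lc L m l k p - Lc L m k l p) * cd (ve m) L p +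
      L p * (Lc L i l k p - Lc L i k l p) = 0 := fun i => by
    have := hL.horizontal_bianchi_contracted hκ hκ0 hR i k l hp
    rw [hc, hc, zero_mul, zero_mul, sub_zero, zero_add] at this
    exact (mul_eq_zero.1 this).resolve_left (hκ0 p hp)
  have ht : ∑ m, (Lc L m l k p - Lc L m k l p) * cd (ve m) L p = 0 := by
    have k0 := key 0
    have k1 := key 1
    have h1 := (hL.euler hp).1
    refine (mul_eq_zero.1 (?_ : (2 * L p) * _ = 0)).resolve_left
      (mul_ne_zero two_ne_zero (hL.ne_zero hp))
    simp only [Fin.sum_univ_two] at k0 k1 h1 ⊢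
    linear_combination cd (ve 0) L p * k0 + cd (ve 1) L p * k1
      - ((Lc L 0 l k p - Lc L 0 k l p) * cd (ve 0) L p +
        (Lc L 1 l k p - Lc L 1 k l p) * cd (ve 1) L p) * h1
  have hi := key i
  rw [ht, mul_zero, zero_add] at hi
  exact sub_eq_zero.1 ((mul_eq_zero.1 hi).resolve_left (hL.ne_zero hp))

theorem vz_curvature (hL : IsCFM 2 D L) (hκ : Sm D κ) (hκ0 : ∀ q ∈ D, κ q ≠ 0)
    (hR : HasConstHolCurv D L κ) (hT : IsKahler L D) (k : Fin 2) (hp : p ∈ D) :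
    cd (vz k) κ p = 0 := by
  have hLp := hL.ne_zero hp
  have key : ∀ i k l, cd (vz k) κ p * (eta i p * cd (ve l) L p + kd i l * L p) =
      cd (vz l) κ p * (eta i p * cd (ve k) L p + kd i k * L p) := fun i k l => by
    have := hL.horizontal_bianchi_contracted hκ hκ0 hR i k l hp
    simp only [hT p hp _ l k, sub_self, zero_mul, mul_zero, Finset.sum_const_zero, add_zero]
      at this
    exact sub_eq_zero.1 this
  have hcross : ∀ k l, cd (vz k) κ p * cd (ve l) L p = cd (vz l) κ p * cd (ve k) L p :=
      fun k l => by
    have k0 := key 0 k l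
    have k1 := key 1 k l
    have h1 := (hL.euler hp).1
    have d1 := sum_mul_kd (fun i => cd (ve i) L p) k
    have d2 := sum_mul_kd (fun i => cd (ve i) L p) l
    refine mul_left_cancel₀ (mul_ne_zero two_ne_zero hLp) ?_
    simp only [Fin.sum_univ_two] at h1 d1 d2
    linear_combination cd (ve 0) L p * k0 + cd (ve 1) L p * k1
      - (cd (vz k) κ p * cd (ve l) L p - cd (vz l) κ p * cd (ve k) L p) * h1
      - cd (vz k) κ p * L p * d2 + cd (vz l) κ p * L p * d1
  have hl : ∀ l, l ≠ k → cd (vz k) κ p = 0 := fun l hlk => by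
    have h1 := key l k l
    have h2 := hcross k l
    simp only [kd, if_neg hlk, if_true] at h1
    refine (mul_eq_zero.1 (?_ : _ * L p = 0)).resolve_right hLp
    linear_combination h1 - eta l p * h2
  obtain ⟨l, hlk⟩ := exists_ne k
  exact hl l hlk

end IsCFM

end Surface

/-- if `R_{r̄ j h̄ k} = 𝒦 (g_{j r̄} g_{k h̄} + g_{k r̄} g_{j h̄})` with `𝒦`
nowhere zero on connected `D`, then `𝒦` is constant iff the metric is Kähler. -/
theorem statement19 (D : Set (Pt 2)) (L : Pt 2 → ℂ) (hL : IsCFM 2 D L)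
    (hconn : IsConnected D) (Kc : Pt 2 → ℝ) (hKs : ContDiffOn ℝ (⊤ : ℕ∞) Kc D)
    (hK0 : ∀ p ∈ D, Kc p ≠ 0)
    (hR : ∀ p ∈ D, ∀ r j h k : Fin 2, Rh L r j h k p =
      (Kc p : ℂ) * (gm L j r p * gm L k h p + gm L k r p * gm L j h p)) :
    (∃ c : ℝ, ∀ p ∈ D, Kc p = c) ↔ IsKahler L D := by
  have hD := hL.openD
  have hκ : Sm D (fun p => (Kc p : ℂ)) := ofRealCLM.contDiff.comp_contDiffOn hKs
  have hκ0 : ∀ q ∈ D, (Kc q : ℂ) ≠ 0 := fun q hq => ofReal_ne_zero.2 (hK0 q hq)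
  have hR' : HasConstHolCurv D L (fun p => (Kc p : ℂ)) := hR
  constructor
  · rintro ⟨c, hc⟩ p hp i j k
    refine hL.torsion_eq_zero hκ hκ0 hR' (fun m => ?_) i k j hp
    rw [cd_congr hD (g := fun _ => (c : ℂ)) (fun q hq => by rw [hc q hq]) _ hp, cd_const]
  · intro hT
    have hreal : ∀ q ∈ D, (starRingEnd ℂ) (Kc q : ℂ) = Kc q := fun q _ => conj_ofReal _
    have hz : ∀ p ∈ D, ∀ k, cd (vz k) (fun p => (Kc p : ℂ)) p = 0 := fun p hp k =>
      hL.vz_curvature hκ hκ0 hR' hT k hp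
    have he : ∀ p ∈ D, ∀ k, cd (ve k) (fun p => (Kc p : ℂ)) p = 0 := fun p hp k =>
      hL.ve_curvature hκ hR' k hp
    obtain ⟨a, ha⟩ := hD.exists_is_const_of_fderiv_eq_zero hconn.isPreconnected
      (𝕜 := ℝ) (f := fun p => (Kc p : ℂ)) (hκ.differentiableOn (by simp)) fun p hp =>
        fderiv_eq_zero_of_cd _ p (hz p hp)
          (fun k => by rw [← hL.conj_cd_vz hκ hreal k hp, hz p hp, map_zero]) (he p hp)
          (fun k => by rw [← hL.conj_cd_ve hκ hreal k hp, he p hp, map_zero])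
    exact ⟨a.re, fun p hp => by rw [← ha p hp, ofReal_re]⟩

end CFinsler
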